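/- Let t be a positive integer, let s ≥ 1 and 1 ≤ j ≤ t be integers, and let n be a nonnegative integer. The number of partitions λ with ℓ(λ) = (s−1)t + j and λ_1 + λ_{t+1} + λ_{2t+1} + ⋯ = n equals the number of t-tuples (μ^(1), …, μ^(t)) of partitions with |μ^(1)| + ⋯ + |μ^(t)| = n such that max_{1≤i≤t} μ^(1)_1, …, μ^(t)_1 equals s and j = max{ i : μ^(i)_1 = s }; that is, s is the largest part size of the corresponding t-colored partition and j is the largest color used on a part of the largest size. (This is the r = 1 refinement produced by the color-conjugate map.) -/

import Mathlib

/-- A partition: a weakly decreasing sequence of naturals with finite support.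
`p.parts i` is the `(i+1)`-st part, i.e. parts are 0-indexed (`λ_1 = p.parts 0`). -/
structure Ptn where
  parts : ℕ → ℕ
  antitone' : ∀ ⦃i j : ℕ⦄, i ≤ j → parts j ≤ parts i
  finite_support' : (Function.support parts).Finite

namespace Ptn

/-- The size `|λ|` of a partition: the sum of all its parts. -/
noncomputable def size (p : Ptn) : ℕ := ∑ᶠ i, p.parts i

/-- The number of (nonzero) parts `ℓ(λ)`. -/
noncomputable def length (p : Ptn) : ℕ := (Function.support p.parts).ncard

/-- A partition has distinct parts if no nonzero value is repeated. -/
def Distinct (p : Ptn) : Prop := ∀ i : ℕ, p.parts (i + 1) ≠ 0 → p.parts (i + 1) < p.parts i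

/-- A partition has odd parts if every part is odd. -/
def OddParts (p : Ptn) : Prop := ∀ i : ℕ, p.parts i ≠ 0 → Odd (p.parts i)

end Ptn

namespace Ptn

@[ext]
theorem ext {p q : Ptn} (h : ∀ i, p.parts i = q.parts i) : p = q := by
  cases p
  cases q
  congr
  exact funext h

theorem exists_forall_parts_eq_zero (p : Ptn) : ∃ N, ∀ i, N ≤ i → p.parts i = 0 := by
  obtain ⟨N, hN⟩ := p.finite_support'.bddAbove
  refine ⟨N + 1, fun i hi => ?_⟩
  by_contra h
  have := hN (Function.mem_support.2 h)
  omega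

theorem exists_parts_le (p : Ptn) (i : ℕ) : ∃ k, p.parts k ≤ i := by
  obtain ⟨N, hN⟩ := p.exists_forall_parts_eq_zero
  exact ⟨N, by simp [hN N le_rfl]⟩

/-- Two sequences vanishing eventually with the same backward recursion coincide. -/
theorem eq_of_eventually_zero_of_step {a b d e : ℕ → ℕ} (ha : ∀ i, a i = d i + a (i + 1))
    (hb : ∀ i, b i = e i + b (i + 1)) (hde : ∀ i, d i = e i) {N : ℕ}
    (hN : ∀ i, N ≤ i → a i = b i) (i : ℕ) : a i = b i := by
  suffices h : ∀ m i, N ≤ i + m → a i = b i from h N i (by omega)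
  intro m
  induction m with
  | zero => exact fun i hi => hN i hi
  | succ m ih =>
    intro i hi
    rw [ha, hb, hde, ih (i + 1) (by omega)]

/-! ### Conjugation -/

open Classical in
/-- The conjugate partition: `p.conj` has as `(i+1)`-st part the number of parts of `p` that
exceed `i`. -/
noncomputable def conj (p : Ptn) : Ptn where
  parts i := Nat.find (p.exists_parts_le i)
  antitone' i j hij := Nat.find_mono fun _ h => h.trans hij
  finite_support' := by
    refine (Set.finite_Iio (p.parts 0)).subset fun i hi => ?_
    by_contra h
    exact hi ((Nat.find_eq_zero _).2 (not_lt.1 h))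

theorem lt_conj_parts_iff (p : Ptn) (i k : ℕ) : k < p.conj.parts i ↔ i < p.parts k := by
  classical
  refine (Nat.lt_find_iff (p.exists_parts_le i) k).trans
    ⟨fun h => not_le.1 (h k le_rfl), fun h m hm => not_le.2 (h.trans_le (p.antitone' hm))⟩

theorem conj_conj (p : Ptn) : p.conj.conj = p := by
  ext i
  refine eq_of_forall_lt_iff fun k => ?_
  rw [lt_conj_parts_iff, lt_conj_parts_iff]

theorem length_eq_conj_parts_zero (p : Ptn) : p.length = p.conj.parts 0 := by
  have h : Function.support p.parts = Set.Iio (p.conj.parts 0) := by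
    ext k
    rw [Set.mem_Iio, lt_conj_parts_iff, Function.mem_support, Nat.pos_iff_ne_zero]
  rw [length, h, ← Finset.coe_Iio, Set.ncard_coe_finset, Nat.card_Iio]

theorem length_conj (p : Ptn) : p.conj.length = p.parts 0 := by
  rw [length_eq_conj_parts_zero, conj_conj]

theorem size_eq_sum_range (p : Ptn) {M N : ℕ} (hM : p.parts 0 ≤ M) (hN : p.conj.parts 0 ≤ N) :
    p.size = ∑ i ∈ Finset.range N, ∑ k ∈ Finset.range M, if k < p.parts i then 1 else 0 := by
  rw [size, finsum_eq_sum_of_support_subset (s := Finset.range N)]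
  · refine Finset.sum_congr rfl fun i _ => ?_
    have hi : p.parts i ≤ M := (p.antitone' (Nat.zero_le i)).trans hM
    rw [Finset.sum_boole, Nat.cast_id, ← Finset.card_range (p.parts i)]
    congr 1
    ext k
    simp only [Finset.card_range, Finset.mem_range, Finset.mem_filter]
    omega
  · intro i hi
    have := (p.lt_conj_parts_iff 0 i).2 (Nat.pos_of_ne_zero hi)
    simp only [Finset.coe_range, Set.mem_Iio]
    omega

theorem size_conj (p : Ptn) : p.conj.size = p.size := by
  rw [p.size_eq_sum_range le_rfl le_rfl,
    p.conj.size_eq_sum_range le_rfl (by rw [conj_conj]), Finset.sum_comm]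
  simp only [lt_conj_parts_iff]

/-- Conjugation as an equivalence. -/
noncomputable def conjEquiv : Ptn ≃ Ptn where
  toFun := conj
  invFun := conj
  left_inv := conj_conj
  right_inv := conj_conj

/-! ### Partitions and their sequences of differences -/

/-- The sequence of differences of consecutive parts; its `c`-th term is the number of parts of
size `c + 1` of the conjugate partition. -/
noncomputable def diff (p : Ptn) : ℕ →₀ ℕ :=
  Finsupp.ofSupportFinite (fun i => p.parts i - p.parts (i + 1))
    (p.finite_support'.subset fun i hi h => hi (by simp [h]))

theorem parts_eq_diff_add (p : Ptn) (i : ℕ) : p.parts i = p.diff i + p.parts (i + 1) :=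
  (Nat.sub_add_cancel (p.antitone' (Nat.le_succ i))).symm

/-- The partition with a given sequence of differences. -/
noncomputable def ofDiff (f : ℕ →₀ ℕ) : Ptn where
  parts i := ∑ c ∈ f.support with i ≤ c, f c
  antitone' i j hij := Finset.sum_le_sum_of_subset fun c hc => by
    simp only [Finset.mem_filter] at hc ⊢
    exact ⟨hc.1, hij.trans hc.2⟩
  finite_support' := by
    refine (Set.finite_Iic (f.support.sup id)).subset fun i hi => ?_
    obtain ⟨c, hc, -⟩ := Finset.exists_ne_zero_of_sum_ne_zero (Function.mem_support.1 hi)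
    rw [Finset.mem_filter] at hc
    exact hc.2.trans (Finset.le_sup (f := id) hc.1)

theorem ofDiff_parts (f : ℕ →₀ ℕ) (i : ℕ) :
    (ofDiff f).parts i = f i + (ofDiff f).parts (i + 1) := by
  have h (m : ℕ) : (ofDiff f).parts m = f.sum fun c x => if m ≤ c then x else 0 :=
    Finset.sum_filter _ _
  have hi : f i = f.sum fun c x => if c = i then x else 0 := by simp
  rw [h, h, hi, ← Finsupp.sum_add]
  refine Finsupp.sum_congr fun c _ => ?_
  split_ifs <;> omega

theorem diff_ofDiff (f : ℕ →₀ ℕ) : (ofDiff f).diff = f := by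
  ext i
  have := (ofDiff f).parts_eq_diff_add i
  rw [ofDiff_parts] at this
  omega

theorem diff_injective : Function.Injective diff := by
  intro p q h
  obtain ⟨M, hM⟩ := p.exists_forall_parts_eq_zero
  obtain ⟨N, hN⟩ := q.exists_forall_parts_eq_zero
  ext i
  exact eq_of_eventually_zero_of_step p.parts_eq_diff_add q.parts_eq_diff_add
    (DFunLike.congr_fun h) (N := max M N)
    (fun i hi => by rw [hM i (by omega), hN i (by omega)]) i

/-- A partition is determined by the sequence of differences of its parts, which is arbitrary. -/
noncomputable def diffEquiv : Ptn ≃ (ℕ →₀ ℕ) where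
  toFun := diff
  invFun := ofDiff
  left_inv p := diff_injective (diff_ofDiff p.diff)
  right_inv := diff_ofDiff

theorem length_le_iff_parts_eq_zero (p : Ptn) (L : ℕ) : p.length ≤ L ↔ p.parts L = 0 := by
  rw [length_eq_conj_parts_zero, ← not_lt, lt_conj_parts_iff]
  omega

theorem length_le_iff_diff (p : Ptn) (L : ℕ) : p.length ≤ L ↔ ∀ c, L ≤ c → p.diff c = 0 := by
  rw [length_le_iff_parts_eq_zero]
  constructor
  · intro h c hc
    have := p.antitone' hc
    have := p.parts_eq_diff_add c
    omega
  · intro h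
    have hconst (m : ℕ) : p.parts (L + m) = p.parts L := by
      induction m with
      | zero => rfl
      | succ m ih => rw [← ih, p.parts_eq_diff_add (L + m), h _ (by omega), zero_add, add_assoc]
    obtain ⟨N, hN⟩ := p.exists_forall_parts_eq_zero
    rw [← hconst N, hN _ (by omega)]

/-! ### The color-conjugate map -/

/-- Splitting a finitely supported sequence into its subsequences along residue classes. -/
noncomputable def residueEquiv (t : ℕ) [NeZero t] : (ℕ →₀ ℕ) ≃ (Fin t → ℕ →₀ ℕ) :=
  (Finsupp.equivCongrLeft ((Nat.divModEquiv t).trans (Equiv.prodComm _ _))).trans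
    (Finsupp.curryEquiv.trans Finsupp.equivFunOnFinite)

theorem residueEquiv_apply (t : ℕ) [NeZero t] (f : ℕ →₀ ℕ) (i : Fin t) (q : ℕ) :
    residueEquiv t f i q = f (q * t + i) := by
  simp [residueEquiv, Nat.divModEquiv]

/-- The color-conjugate map: a column of length `q * t + i + 1` of the diagram becomes a part of
size `q + 1` and color `i`. -/
noncomputable def colorConj (t : ℕ) [NeZero t] : Ptn ≃ (Fin t → Ptn) :=
  (diffEquiv.trans (residueEquiv t)).trans
    (Equiv.piCongrRight fun _ => diffEquiv.symm.trans conjEquiv)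

theorem diff_conj_colorConj (t : ℕ) [NeZero t] (p : Ptn) (i : Fin t) (q : ℕ) :
    (colorConj t p i).conj.diff q = p.diff (q * t + i) := by
  rw [← residueEquiv_apply]
  change ((ofDiff (residueEquiv t p.diff i)).conj.conj).diff q = _
  rw [conj_conj, diff_ofDiff]

theorem parts_eq_sum_diff_add (p : Ptn) (m t : ℕ) :
    p.parts m = ∑ i ∈ Finset.range t, p.diff (m + i) + p.parts (m + t) := by
  induction t with
  | zero => simp
  | succ t ih => rw [Finset.sum_range_succ, add_assoc, ← add_assoc m, ← parts_eq_diff_add, ← ih]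

theorem parts_mul_eq_sum_colorConj (t : ℕ) [NeZero t] (p : Ptn) (k : ℕ) :
    p.parts (k * t) = ∑ i, (colorConj t p i).conj.parts k := by
  obtain ⟨M, hM⟩ := p.exists_forall_parts_eq_zero
  choose N hN using fun i => (colorConj t p i).conj.exists_forall_parts_eq_zero
  refine eq_of_eventually_zero_of_step (a := fun k => p.parts (k * t))
    (b := fun k => ∑ i, (colorConj t p i).conj.parts k)
    (d := fun k => ∑ i ∈ Finset.range t, p.diff (k * t + i))
    (e := fun k => ∑ i, (colorConj t p i).conj.diff k) (N := max M (Finset.univ.sup N))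
    (fun k => ?_) (fun k => ?_) (fun k => ?_) (fun k hk => ?_) k
  · rw [add_one_mul]
    exact p.parts_eq_sum_diff_add _ _
  · rw [← Finset.sum_add_distrib]
    exact Finset.sum_congr rfl fun i _ => parts_eq_diff_add _ _
  · simp only [diff_conj_colorConj]
    exact Finset.sum_range fun i => p.diff (k * t + i)
  · have hMk : M ≤ k * t :=
      ((le_max_left _ _).trans hk).trans (Nat.le_mul_of_pos_right k (NeZero.pos t))
    change p.parts (k * t) = _
    rw [hM _ hMk, eq_comm]
    exact Finset.sum_eq_zero fun i hi =>
      hN i k (((Finset.le_sup hi).trans (le_max_right _ _)).trans hk)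

theorem finsum_parts_mul_eq_sum_size (t : ℕ) [NeZero t] (p : Ptn) :
    ∑ᶠ k : ℕ, p.parts (k * t) = ∑ i, (colorConj t p i).size := by
  simp only [parts_mul_eq_sum_colorConj, ← size_conj (colorConj t p _)]
  exact finsum_sum_comm _ _ fun i _ => (colorConj t p i).conj.finite_support'

theorem length_le_iff_colorConj (t : ℕ) [NeZero t] (p : Ptn) {m j : ℕ} (hj : j ≤ t) :
    p.length ≤ m * t + j ↔
      ∀ i : Fin t, (colorConj t p i).parts 0 ≤ if (i : ℕ) < j then m + 1 else m := by
  simp only [← length_conj, length_le_iff_diff, diff_conj_colorConj]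
  constructor
  · intro h i q hq
    refine h _ ?_
    split_ifs at hq with hi
    · nlinarith
    · nlinarith
  · intro h c hc
    have hc' := Nat.div_add_mod' c t
    have hlt := Nat.mod_lt c (NeZero.pos t)
    have := h ⟨c % t, hlt⟩ (c / t) ?_
    · rwa [hc'] at this
    · dsimp only
      split_ifs with hi
      · by_contra! hq
        nlinarith
      · by_contra! hq
        nlinarith

theorem length_eq_iff_colorConj (t : ℕ) [NeZero t] (p : Ptn) {s j : ℕ} (hs : 1 ≤ s)
    (hj1 : 1 ≤ j) (hjt : j ≤ t) :
    p.length = (s - 1) * t + j ↔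
      (Finset.univ.sup fun i => (colorConj t p i).parts 0) = s ∧
        ∃ i : Fin t, (i : ℕ) + 1 = j ∧ (colorConj t p i).parts 0 = s ∧
          ∀ i' : Fin t, (colorConj t p i').parts 0 = s → i' ≤ i := by
  have hle := length_le_iff_colorConj t p (m := s - 1) hjt
  have hlt := length_le_iff_colorConj t p (m := s - 1) (j := j - 1) (by omega)
  have hiff : p.length = (s - 1) * t + j ↔
      p.length ≤ (s - 1) * t + j ∧ ¬ p.length ≤ (s - 1) * t + (j - 1) := by omega
  rw [hiff, hle, hlt]
  generalize colorConj t p = μ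
  constructor
  · rintro ⟨h, h'⟩
    push Not at h'
    obtain ⟨i, hi⟩ := h'
    have hi' := h i
    have hij : (i : ℕ) + 1 = j ∧ (μ i).parts 0 = s := by
      split_ifs at hi hi' <;> omega
    refine ⟨le_antisymm (Finset.sup_le fun k _ => ?_) ?_, i, hij.1, hij.2, fun k hk => ?_⟩
    · have := h k
      split_ifs at this <;> omega
    · exact hij.2 ▸ Finset.le_sup (f := fun i => (μ i).parts 0) (Finset.mem_univ i)
    · have := h k
      rw [Fin.le_def]
      split_ifs at this <;> omega
  · rintro ⟨hsup, i, hij, his, hmax⟩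
    refine ⟨fun k => ?_, fun h => ?_⟩
    · have hk : (μ k).parts 0 ≤ s :=
        hsup ▸ Finset.le_sup (f := fun i => (μ i).parts 0) (Finset.mem_univ k)
      have hk' := hmax k
      rw [Fin.le_def] at hk'
      split_ifs <;> omega
    · have := h i
      split_ifs at this <;> omega

end Ptn

/-- The `r = 1` refinement given by the color-conjugate map: partitions `λ` with
`ℓ(λ) = (s-1)t + j` and `λ_1 + λ_{t+1} + λ_{2t+1} + ⋯ = n` are equinumerous with
`t`-colored partitions of `n` (encoded as `t`-tuples `μ`, `μ i` holding the parts of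
color `i+1`) in which `s` is the largest part size and `j` is the largest color used on
a part of the largest size. -/
theorem color_conjugate_refinement (t s j n : ℕ) (ht : 1 ≤ t) (hs : 1 ≤ s)
    (hj1 : 1 ≤ j) (hjt : j ≤ t) :
    {p : Ptn | p.length = (s - 1) * t + j ∧ (∑ᶠ k : ℕ, p.parts (k * t)) = n}.ncard
      = {μ : Fin t → Ptn | (∑ i, (μ i).size) = n ∧
          (Finset.univ.sup fun i => (μ i).parts 0) = s ∧
          ∃ i : Fin t, (i : ℕ) + 1 = j ∧ (μ i).parts 0 = s ∧
            ∀ i' : Fin t, (μ i').parts 0 = s → i' ≤ i}.ncard := by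
  have : NeZero t := ⟨by omega⟩
  rw [← Set.ncard_preimage_of_injective_subset_range (Ptn.colorConj t).injective
    (by simp [(Ptn.colorConj t).surjective.range_eq])]
  congr 1
  ext p
  simp only [Set.mem_ofPred_eq, Set.mem_preimage, Ptn.finsum_parts_mul_eq_sum_size t,
    Ptn.length_eq_iff_colorConj t p hs hj1 hjt]
  exact and_comm
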